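/- arXiv:2306.16506 — 5 statements merged into one kernel-verified Lean document; each statement's English description precedes it below -/
import Mathlib

section
/- Let A be an invertible 2×2 real matrix with det A > 0, let s ∈ ℝ², let x : ℝ² → ℝ be measurable, and let r, φ, θ ∈ ℝ be such that n(θ) = Aᵀ n(φ) / ‖Aᵀ n(φ)‖. Then ℛ(u ↦ x(A⁻¹·(u − s)))(r, φ) = (det A / ‖Aᵀ n(φ)‖) · (ℛx)((r − ⟨s, n(φ)⟩) / ‖Aᵀ n(φ)‖, θ), where ⟨·,·⟩ and ‖·‖ denote the Euclidean inner product and norm on ℝ². (Transformation behaviour of the Radon transform under the group Aff⁺(2) of invertible affine transforms with positive determinant.) -/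
open Matrix MeasureTheory

/-- The normal direction `n(φ) = (cos φ, sin φ)`. -/
noncomputable def nvec (φ : ℝ) : Fin 2 → ℝ := ![Real.cos φ, Real.sin φ]

/-- The tangent direction `n⊥(φ) = (−sin φ, cos φ)`. -/
noncomputable def nperp (φ : ℝ) : Fin 2 → ℝ := ![-Real.sin φ, Real.cos φ]

/-- The Euclidean inner product on `ℝ²`. -/
def dot2 (u v : Fin 2 → ℝ) : ℝ := u 0 * v 0 + u 1 * v 1

/-- The Euclidean norm on `ℝ²`. -/
noncomputable def enorm2 (u : Fin 2 → ℝ) : ℝ := Real.sqrt (u 0 ^ 2 + u 1 ^ 2)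

/-- The Radon transform `(ℛx)(r, φ) = ∫ x(r·n(φ) + t·n⊥(φ)) dt`. -/
noncomputable def radon (x : (Fin 2 → ℝ) → ℝ) (r φ : ℝ) : ℝ :=
  ∫ t : ℝ, x (r • nvec φ + t • nperp φ)

theorem nvec_orthonormal_expansion (w : Fin 2 → ℝ) (θ : ℝ) :
    w = dot2 w (nvec θ) • nvec θ + dot2 w (nperp θ) • nperp θ := by
  have h := Real.sin_sq_add_cos_sq θ
  ext i
  fin_cases i <;> simp [dot2, nvec, nperp]
  · linear_combination (-w 0) * h
  · linear_combination (-w 1) * h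

theorem dot2_mulVec (A : Matrix (Fin 2) (Fin 2) ℝ) (u v : Fin 2 → ℝ) :
    dot2 (A *ᵥ u) v = dot2 u (Aᵀ *ᵥ v) := by
  simp [dot2, Matrix.mulVec, dotProduct, Fin.sum_univ_two]
  ring

theorem nvec_ne_zero (θ : ℝ) : nvec θ ≠ 0 := by
  intro h
  have h0 : Real.cos θ = 0 := congrFun h 0
  have h1 : Real.sin θ = 0 := congrFun h 1
  have h2 := Real.sin_sq_add_cos_sq θ
  simp [h0, h1] at h2

theorem mulVec_nperp (A : Matrix (Fin 2) (Fin 2) ℝ) {c φ θ : ℝ}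
    (h : Aᵀ *ᵥ nvec φ = c • nvec θ) : A *ᵥ (c • nperp θ) = A.det • nperp φ := by
  have h0 := congrFun h 0
  have h1 := congrFun h 1
  simp [Matrix.mulVec, dotProduct, Fin.sum_univ_two, nvec] at h0 h1
  ext i
  fin_cases i <;>
    simp [Matrix.mulVec, dotProduct, Fin.sum_univ_two, nperp, Matrix.det_fin_two]
  · linear_combination A 0 0 * h1 - A 0 1 * h0
  · linear_combination A 1 0 * h1 - A 1 1 * h0

/-- Transformation behaviour of the Radon transform under `Aff⁺(2)`:
for invertible `A` with `det A > 0` and `n(θ) = Aᵀ n(φ) / ‖Aᵀ n(φ)‖`,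
`ℛ(u ↦ x(A⁻¹·(u − s)))(r, φ)
  = (det A / ‖Aᵀ n(φ)‖) · (ℛx)((r − ⟨s, n(φ)⟩) / ‖Aᵀ n(φ)‖, θ)`. -/
theorem stmt_8 (A : Matrix (Fin 2) (Fin 2) ℝ) (hA : IsUnit A) (hdet : 0 < A.det)
    (s : Fin 2 → ℝ) (x : (Fin 2 → ℝ) → ℝ) (hx : Measurable x) (r φ θ : ℝ)
    (hθ : nvec θ = (enorm2 (Aᵀ *ᵥ nvec φ))⁻¹ • (Aᵀ *ᵥ nvec φ)) :
    radon (fun u => x (A⁻¹ *ᵥ (u - s))) r φ =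
      (A.det / enorm2 (Aᵀ *ᵥ nvec φ)) *
        radon x ((r - dot2 s (nvec φ)) / enorm2 (Aᵀ *ᵥ nvec φ)) θ := by
  have hdetu : IsUnit A.det := hdet.ne'.isUnit
  set N := enorm2 (Aᵀ *ᵥ nvec φ) with hN
  have hN0 : N ≠ 0 := by
    intro h
    rw [h, _root_.inv_zero, zero_smul] at hθ
    exact nvec_ne_zero θ hθ
  have hNpos : 0 < N := (Real.sqrt_nonneg _).lt_of_ne' hN0
  have hAn : Aᵀ *ᵥ nvec φ = N • nvec θ := by rw [hθ, smul_inv_smul₀ hN0]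
  have hperp : A⁻¹ *ᵥ nperp φ = (N / A.det) • nperp θ := by
    have h := congrArg (fun v => A.det⁻¹ • (A⁻¹ *ᵥ v)) (mulVec_nperp A hAn)
    simp only [Matrix.mulVec_mulVec, Matrix.nonsing_inv_mul A hdetu, Matrix.one_mulVec,
      Matrix.mulVec_smul, inv_smul_smul₀ hdet.ne', smul_smul] at h
    rw [← h, div_eq_inv_mul]
  set w := A⁻¹ *ᵥ (r • nvec φ - s) with hw
  have hAw : A *ᵥ w = r • nvec φ - s := by
    rw [hw, Matrix.mulVec_mulVec, Matrix.mul_nonsing_inv A hdetu, Matrix.one_mulVec]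
  have hwn : dot2 w (nvec θ) = (r - dot2 s (nvec φ)) / N := by
    have h := dot2_mulVec A w (nvec φ)
    rw [hAw, hAn] at h
    have hφ := Real.sin_sq_add_cos_sq φ
    simp only [dot2, nvec, Pi.sub_apply, Pi.smul_apply, smul_eq_mul, Matrix.cons_val_zero,
      Matrix.cons_val_one] at h ⊢
    rw [eq_div_iff hN0]
    linear_combination -h + r * hφ
  have hline : ∀ t : ℝ, A⁻¹ *ᵥ (r • nvec φ + t • nperp φ - s) =
      ((r - dot2 s (nvec φ)) / N) • nvec θ
        + (N / A.det * t + dot2 w (nperp θ)) • nperp θ := by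
    intro t
    rw [add_sub_right_comm, Matrix.mulVec_add, ← hw, Matrix.mulVec_smul, hperp, ← hwn]
    conv_lhs => rw [nvec_orthonormal_expansion w θ]
    module
  simp only [radon, hline]
  set p := (r - dot2 s (nvec φ)) / N
  rw [Measure.integral_comp_mul_left
      (fun t => x (p • nvec θ + (t + dot2 w (nperp θ)) • nperp θ)) (N / A.det),
    integral_add_right_eq_self (fun t => x (p • nvec θ + t • nperp θ)),
    inv_div, abs_of_pos (div_pos hdet hNpos), smul_eq_mul]
end

section
/- The map τ defines an action of the roto-translation group SE(2) on the sinogram domain: for all s₁, s₂ ∈ ℝ² and all γ₁, γ₂, r, φ ∈ ℝ, τ(s₁ + R(γ₁)·s₂, γ₁ + γ₂)(r, φ) = τ(s₁, γ₁)(τ(s₂, γ₂)(r, φ)), and τ(0, 0)(r, φ) = (r, φ). -/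
open Matrix

/-- The rotation matrix `R(γ)`. -/
noncomputable def Rmat (γ : ℝ) : Matrix (Fin 2) (Fin 2) ℝ :=
  !![Real.cos γ, -Real.sin γ; Real.sin γ, Real.cos γ]

/-- The induced action of `SE(2)` on the sinogram domain:
`τ(s, γ)(r, φ) = (r + ⟨s, n(φ + γ)⟩, φ + γ)`. -/
noncomputable def tau (s : Fin 2 → ℝ) (γ : ℝ) : ℝ × ℝ → ℝ × ℝ :=
  fun p => (p.1 + dot2 s (nvec (p.2 + γ)), p.2 + γ)

/-- `R(γ)` rotates the pairing with `n`: `⟨R(γ)·s, n(θ + γ)⟩ = ⟨s, n(θ)⟩`. -/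
theorem dot2_Rmat_mulVec_nvec_add (s : Fin 2 → ℝ) (γ θ : ℝ) :
    dot2 (Rmat γ *ᵥ s) (nvec (θ + γ)) = dot2 s (nvec θ) := by
  simp only [dot2, Rmat, nvec, mulVec, dotProduct, Fin.sum_univ_two, of_apply, cons_val_zero,
    cons_val_one, Real.cos_add, Real.sin_add]
  linear_combination (s 0 * Real.cos θ + s 1 * Real.sin θ) * Real.cos_sq_add_sin_sq γ

theorem dot2_add_left (u v w : Fin 2 → ℝ) : dot2 (u + v) w = dot2 u w + dot2 v w := by
  simp only [dot2, Pi.add_apply]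
  ring

/-- `τ` defines an action of `SE(2)` on the sinogram domain:
`τ((s₁, γ₁)·(s₂, γ₂)) = τ(s₁, γ₁) ∘ τ(s₂, γ₂)` and `τ(0,0) = id`. -/
theorem stmt_9 (s₁ s₂ : Fin 2 → ℝ) (γ₁ γ₂ r φ : ℝ) :
    tau (s₁ + Rmat γ₁ *ᵥ s₂) (γ₁ + γ₂) (r, φ) = tau s₁ γ₁ (tau s₂ γ₂ (r, φ)) ∧
      tau 0 0 (r, φ) = (r, φ) := by
  refine ⟨?_, by simp [tau, dot2]⟩
  have h : φ + (γ₁ + γ₂) = φ + γ₂ + γ₁ := by ring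
  simp only [tau, h, dot2_add_left, dot2_Rmat_mulVec_nvec_add, Prod.mk.injEq, and_true]
  ring
end

section
/- Let a : ℝ → ℝ and x : ℝ² → ℝ be measurable, and define the operator (𝒜x)(r, φ) = ∫_{ℝ²} a(r − ⟨u, n(φ)⟩) · x(u) du (Lebesgue integral over u ∈ ℝ²). Then 𝒜 intertwines the roto-translation action on ℝ² with the induced SE(2)-action on the sinogram domain: for all s ∈ ℝ² and γ, r, φ ∈ ℝ, 𝒜(u ↦ x(R(−γ)·(u − s)))(r, φ) = (𝒜x)(r − ⟨s, n(φ)⟩, φ − γ). (Instance of the 'if' direction of the representer theorem: every generalized convolution with a kernel satisfying the stabilizer constraint is equivariant.) -/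
open Matrix MeasureTheory

/-- The generalized convolution operator
`(𝒜x)(r, φ) = ∫_{ℝ²} a(r − ⟨u, n(φ)⟩) · x(u) du`. -/
noncomputable def Aop (a : ℝ → ℝ) (x : (Fin 2 → ℝ) → ℝ) (r φ : ℝ) : ℝ :=
  ∫ u : Fin 2 → ℝ, a (r - dot2 u (nvec φ)) * x u

lemma det_Rmat (γ : ℝ) : (Rmat γ).det = 1 := by
  rw [Rmat, det_fin_two_of]
  linear_combination Real.cos_sq_add_sin_sq γ

lemma measurePreserving_Rmat_mulVec (γ : ℝ) :
    MeasurePreserving (fun u : Fin 2 → ℝ => Rmat γ *ᵥ u) where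
  measurable := (Continuous.matrix_mulVec continuous_const continuous_id).measurable
  map_eq := by
    have h := Real.map_matrix_volume_pi_eq_smul_volume_pi (M := Rmat γ) (by simp [det_Rmat])
    rwa [det_Rmat, inv_one, abs_one, ENNReal.ofReal_one, one_smul] at h

lemma dot2_sub_left (u v w : Fin 2 → ℝ) : dot2 (u - v) w = dot2 u w - dot2 v w := by
  simp only [dot2, Pi.sub_apply]
  ring

lemma dot2_Rmat_mulVec (γ φ : ℝ) (u : Fin 2 → ℝ) :
    dot2 (Rmat γ *ᵥ u) (nvec φ) = dot2 u (nvec (φ - γ)) := by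
  simp only [dot2, Rmat, nvec]
  simp [Matrix.mulVec, dotProduct, Fin.sum_univ_two, Real.cos_sub, Real.sin_sub]
  ring

/-- Every generalized convolution of Radon type intertwines the roto-translation action
on `ℝ²` with the induced `SE(2)`-action on the sinogram domain:
`𝒜(u ↦ x(R(−γ)·(u − s)))(r, φ) = (𝒜x)(r − ⟨s, n(φ)⟩, φ − γ)`. -/
theorem stmt_12 (a : ℝ → ℝ) (ha : Measurable a)
    (x : (Fin 2 → ℝ) → ℝ) (hx : Measurable x)
    (s : Fin 2 → ℝ) (γ r φ : ℝ) :
    Aop a (fun u => x (Rmat (-γ) *ᵥ (u - s))) r φ =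
      Aop a x (r - dot2 s (nvec φ)) (φ - γ) := by
  have hT : MeasurePreserving (fun u : Fin 2 → ℝ => Rmat (-γ) *ᵥ (u - s)) :=
    (measurePreserving_Rmat_mulVec (-γ)).comp (measurePreserving_sub_right volume s)
  have hF : Measurable fun v : Fin 2 → ℝ =>
      a (r - dot2 s (nvec φ) - dot2 v (nvec (φ - γ))) * x v := by
    unfold dot2
    fun_prop
  unfold Aop
  conv_rhs => rw [← hT.map_eq]
  rw [integral_map hT.aemeasurable hF.aestronglyMeasurable]
  simp only [dot2_Rmat_mulVec, dot2_sub_left, sub_neg_eq_add, sub_add_cancel,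
    sub_sub, add_sub_cancel]
end

section
/- Let K : ℝ² → ℝ → ℝ → ℝ be a kernel satisfying the SE(2)-invariance K(R(γ)·u + s)(r + ⟨s, n(φ + γ)⟩)(φ + γ) = K(u)(r)(φ) for all s ∈ ℝ² and all γ, r, φ ∈ ℝ and u ∈ ℝ². Then there exists a function a : ℝ → ℝ (namely a(r) = K(0)(r)(0)) such that K(u)(r)(φ) = a(r − ⟨u, n(φ)⟩) for all u ∈ ℝ² and r, φ ∈ ℝ. (The 'only if' direction of the representer theorem specialized to the SE(2)-symmetries of the Radon transform: every operator kernel that transforms translations and rotations exactly like the Radon operator is of Radon-convolution type.) -/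
open Matrix

/-- Representer theorem for the `SE(2)`-symmetries of the Radon transform:
every kernel `K` satisfying the invariance
`K(R(γ)·u + s)(r + ⟨s, n(φ + γ)⟩)(φ + γ) = K(u)(r)(φ)`
is of Radon-convolution type: `K(u)(r)(φ) = a(r − ⟨u, n(φ)⟩)` with `a(r) = K(0)(r)(0)`. -/
theorem stmt_13 (Kk : (Fin 2 → ℝ) → ℝ → ℝ → ℝ)
    (hK : ∀ (s u : Fin 2 → ℝ) (γ r φ : ℝ),
      Kk (Rmat γ *ᵥ u + s) (r + dot2 s (nvec (φ + γ))) (φ + γ) = Kk u r φ) :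
    ∃ a : ℝ → ℝ, (∀ r : ℝ, a r = Kk 0 r 0) ∧
      ∀ (u : Fin 2 → ℝ) (r φ : ℝ), Kk u r φ = a (r - dot2 u (nvec φ)) := by
  refine ⟨fun r => Kk 0 r 0, fun _ => rfl, fun u r φ => ?_⟩
  simpa using hK u 0 φ (r - dot2 u (nvec φ)) 0
end

section
/- Let b : ℝ → ℝ → ℝ satisfy the Aff⁺(2)-kernel constraint: for every invertible 2×2 real matrix A with det A > 0 and all r, φ, θ ∈ ℝ with n(θ) = Aᵀ n(φ) / ‖Aᵀ n(φ)‖, one has b(r / ‖Aᵀ n(φ)‖)(θ) = ‖Aᵀ n(φ)‖ · b(r)(φ). Then b is independent of the angle, i.e., b(r)(φ) = b(r)(0) for all r, φ ∈ ℝ, and the function a(r) = b(r)(0) is positively homogeneous of degree −1, i.e., a(c·r) = c⁻¹ · a(r) for all c > 0 and r ∈ ℝ. (The constraint derived in the representer theorem for operators sharing the Aff⁺(2)-symmetries of the Radon transform forces angle-independent, degree −1 homogeneous kernels.) -/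
open Matrix

theorem nvec_smul_rotation (c φ θ : ℝ) :
    (!![c * Real.cos (θ - φ), c * Real.sin (θ - φ);
        -(c * Real.sin (θ - φ)), c * Real.cos (θ - φ)] : Matrix (Fin 2) (Fin 2) ℝ)ᵀ *ᵥ nvec φ =
      c • nvec θ := by
  have h : θ = (θ - φ) + φ := by ring
  have hc := congrArg Real.cos h
  have hs := congrArg Real.sin h
  rw [Real.cos_add] at hc
  rw [Real.sin_add] at hs
  ext i
  fin_cases i
  · simp [nvec, Matrix.mulVec, dotProduct, Fin.sum_univ_two]
    linear_combination -c * hc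
  · simp [nvec, Matrix.mulVec, dotProduct, Fin.sum_univ_two]
    linear_combination -c * hs

theorem enorm2_smul_nvec {c : ℝ} (hc : 0 ≤ c) (θ : ℝ) : enorm2 (c • nvec θ) = c := by
  have h : (c * Real.cos θ) ^ 2 + (c * Real.sin θ) ^ 2 = c ^ 2 := by
    linear_combination c ^ 2 * Real.cos_sq_add_sin_sq θ
  simp [enorm2, nvec, h, Real.sqrt_sq hc]

/-- The `Aff⁺(2)`-kernel constraint of the representer theorem forces angle-independent
kernels that are positively homogeneous of degree `−1`: if
`b(r / ‖Aᵀn(φ)‖)(θ) = ‖Aᵀn(φ)‖ · b(r)(φ)` whenever `A` is invertible with `det A > 0`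
and `n(θ) = Aᵀn(φ)/‖Aᵀn(φ)‖`, then `b(r)(φ) = b(r)(0)` and
`a(r) = b(r)(0)` satisfies `a(c·r) = c⁻¹·a(r)` for all `c > 0`. -/
theorem stmt_15 (b : ℝ → ℝ → ℝ)
    (hb : ∀ A : Matrix (Fin 2) (Fin 2) ℝ, IsUnit A → 0 < A.det →
      ∀ r φ θ : ℝ, nvec θ = (enorm2 (Aᵀ *ᵥ nvec φ))⁻¹ • (Aᵀ *ᵥ nvec φ) →
        b (r / enorm2 (Aᵀ *ᵥ nvec φ)) θ = enorm2 (Aᵀ *ᵥ nvec φ) * b r φ) :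
    (∀ r φ : ℝ, b r φ = b r 0) ∧
      (∀ c : ℝ, 0 < c → ∀ r : ℝ, b (c * r) 0 = c⁻¹ * b r 0) := by
  have key : ∀ c : ℝ, 0 < c → ∀ r φ θ : ℝ, b (r / c) θ = c * b r φ := by
    intro c hc r φ θ
    have hdet : 0 < (!![c * Real.cos (θ - φ), c * Real.sin (θ - φ);
        -(c * Real.sin (θ - φ)), c * Real.cos (θ - φ)] : Matrix (Fin 2) (Fin 2) ℝ).det := by
      have h : c * Real.cos (θ - φ) * (c * Real.cos (θ - φ)) -
          c * Real.sin (θ - φ) * -(c * Real.sin (θ - φ)) = c ^ 2 := by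
        linear_combination c ^ 2 * Real.cos_sq_add_sin_sq (θ - φ)
      rw [Matrix.det_fin_two_of, h]
      positivity
    have h := hb _ ((Matrix.isUnit_iff_isUnit_det _).2 hdet.ne'.isUnit) hdet r φ θ
    rw [nvec_smul_rotation, enorm2_smul_nvec hc.le] at h
    exact h (inv_smul_smul₀ hc.ne' _).symm
  refine ⟨fun r φ => ?_, fun c hc r => ?_⟩
  · simpa using key 1 one_pos r 0 φ
  · simpa [mul_comm] using key c⁻¹ (inv_pos.2 hc) r 0 0
end
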